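/- Assume 𝓡₀ > 1 and define c_* := min_{γ>0} [η(𝓡₀ - 1) + λ(e^{-γ} - 2 + e^{γ})]/γ. Then for every c ≥ c_* there exists a traveling wave solution, that is, smooth functions S, I : ℝ → ℝ with 0 < S(x) < s₀, I(x) > 0 bounded, satisfying -c S'(x) = -τ S(x) I(x) and -c I'(x) = τ S(x) I(x) - η I(x) + λ(I(x-1) - 2 I(x) + I(x+1)) for all x ∈ ℝ, with S(x) → s₀ as x → +∞ and I(x) → 0 as x → ±∞. Moreover any such solution satisfies S(x) → s₀ e^{-τ I_*} as x → -∞, where I_* is the unique positive zero of f. -/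

import Mathlib

/-- The nonlinearity `f(v) = s₀(1 - e^{-τ v}) - η v`. -/
noncomputable def fSIR (τ η s₀ v : ℝ) : ℝ := s₀ * (1 - Real.exp (-τ * v)) - η * v

/-- A traveling wave solution of speed `c` for the lattice SIR system: smooth profiles
`S, I : ℝ → ℝ` with `0 < S < s₀`, `I > 0` bounded, satisfying
`-c S' = -τ S I` and `-c I' = τ S I - η I + λ(I(·-1) - 2 I + I(·+1))` on `ℝ`,
with `S(+∞) = s₀` and `I(±∞) = 0`. -/
def IsTravelingWave (τ η lam s₀ c : ℝ) (S I : ℝ → ℝ) : Prop :=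
  ContDiff ℝ (⊤ : ℕ∞) S ∧ ContDiff ℝ (⊤ : ℕ∞) I ∧
  (∀ x, 0 < S x ∧ S x < s₀) ∧ (∀ x, 0 < I x) ∧ (∃ M : ℝ, ∀ x, I x ≤ M) ∧
  (∀ x : ℝ, -c * deriv S x = -τ * S x * I x) ∧
  (∀ x : ℝ, -c * deriv I x =
      τ * S x * I x - η * I x + lam * (I (x - 1) - 2 * I x + I (x + 1))) ∧
  Filter.Tendsto S Filter.atTop (nhds s₀) ∧
  Filter.Tendsto I Filter.atTop (nhds 0) ∧
  Filter.Tendsto I Filter.atBot (nhds 0)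

open Set Filter Topology MeasureTheory

noncomputable def Eop (a : ℝ) (g : ℝ → ℝ) (x : ℝ) : ℝ :=
  ∫ t in Ioi (0:ℝ), a * Real.exp (-a * t) * g (x + t)

lemma kernel_int {a : ℝ} (ha : 0 < a) : IntegrableOn (fun t => a * Real.exp (-a * t)) (Ioi 0) :=
  (integrableOn_exp_mul_Ioi (by linarith) 0).const_mul a

lemma Eop_int {a M : ℝ} (ha : 0 < a) {g : ℝ → ℝ} (hg : Measurable g) (hb : ∀ y, |g y| ≤ M) (x : ℝ) :
    IntegrableOn (fun t => a * Real.exp (-a * t) * g (x + t)) (Ioi 0) := by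
  refine (kernel_int ha).mul_bdd (c := M) ?_ ?_
  · exact (hg.comp (measurable_const_add x)).aestronglyMeasurable
  · exact Eventually.of_forall fun t => hb _

lemma Eop_exp {a γ K : ℝ} (ha : 0 < a) (hγ : 0 ≤ γ) (x : ℝ) :
    Eop a (fun y => K * Real.exp (-γ * y)) x = a / (a + γ) * (K * Real.exp (-γ * x)) := by
  unfold Eop
  have : ∀ t : ℝ, a * Real.exp (-a * t) * (K * Real.exp (-γ * (x + t)))
      = (a * K * Real.exp (-γ * x)) * Real.exp (-(a + γ) * t) := by
    intro t
    have h1 : Real.exp (-γ * (x + t)) = Real.exp (-γ * x) * Real.exp (-γ * t) := by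
      rw [← Real.exp_add]; congr 1; ring
    have h2 : Real.exp (-(a + γ) * t) = Real.exp (-a * t) * Real.exp (-γ * t) := by
      rw [← Real.exp_add]; congr 1; ring
    rw [h1, h2]; ring
  simp_rw [this]
  rw [integral_const_mul, integral_exp_mul_Ioi (by linarith)]
  have : a + γ ≠ 0 := by positivity
  simp only [mul_zero, Real.exp_zero]
  rw [neg_div_neg_eq]
  field_simp

lemma exp_int' {a γ K : ℝ} (ha : 0 < a) (hγ : 0 ≤ γ) (x : ℝ) :
    IntegrableOn (fun t => a * Real.exp (-a * t) * (K * Real.exp (-γ * (x + t)))) (Ioi 0) := by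
  have : ∀ t : ℝ, a * Real.exp (-a * t) * (K * Real.exp (-γ * (x + t)))
      = (a * K * Real.exp (-γ * x)) * Real.exp (-(a + γ) * t) := by
    intro t
    have h1 : Real.exp (-γ * (x + t)) = Real.exp (-γ * x) * Real.exp (-γ * t) := by
      rw [← Real.exp_add]; congr 1; ring
    have h2 : Real.exp (-(a + γ) * t) = Real.exp (-a * t) * Real.exp (-γ * t) := by
      rw [← Real.exp_add]; congr 1; ring
    rw [h1, h2]; ring
  simp_rw [this]
  exact (integrableOn_exp_mul_Ioi (by linarith) 0).const_mul _

lemma Eop_const {a : ℝ} (ha : 0 < a) (k x : ℝ) : Eop a (fun _ => k) x = k := by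
  have := Eop_exp (a := a) (γ := 0) (K := k) ha le_rfl x
  simp at this
  rw [this, div_self ha.ne', one_mul]

lemma Eop_mono' {a : ℝ} (ha : 0 < a) {g h : ℝ → ℝ} {x y : ℝ}
    (hg : IntegrableOn (fun t => a * Real.exp (-a * t) * g (x + t)) (Ioi 0))
    (hh : IntegrableOn (fun t => a * Real.exp (-a * t) * h (y + t)) (Ioi 0))
    (hle : ∀ t, g (x + t) ≤ h (y + t)) : Eop a g x ≤ Eop a h y := by
  unfold Eop
  refine integral_mono hg hh fun t => ?_
  exact mul_le_mul_of_nonneg_left (hle t) (by positivity)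

lemma Eop_tendsto {ι : Type*} {l : Filter ι} [l.IsCountablyGenerated] {a M : ℝ} (ha : 0 < a)
    (G : ι → ℝ → ℝ) (xs : ι → ℝ) (lim : ℝ → ℝ) (y : ℝ) (hG : ∀ i, Measurable (G i))
    (hb : ∀ i y, |G i y| ≤ M)
    (ht : ∀ t, Tendsto (fun i => G i (xs i + t)) l (𝓝 (lim (y + t)))) :
    Tendsto (fun i => Eop a (G i) (xs i)) l (𝓝 (Eop a lim y)) := by
  unfold Eop
  refine tendsto_integral_filter_of_dominated_convergence
    (fun t => a * Real.exp (-a * t) * M) ?_ ?_ ?_ ?_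
  · exact Eventually.of_forall fun i => (Eop_int ha (hG i) (hb i) (xs i)).aestronglyMeasurable
  · refine Eventually.of_forall fun i => Eventually.of_forall fun t => ?_
    rw [norm_mul, Real.norm_of_nonneg (by positivity)]
    exact mul_le_mul_of_nonneg_left (hb _ _) (by positivity)
  · exact (kernel_int ha).mul_const M
  · exact Eventually.of_forall fun t => (ht t).const_mul _

lemma Phi_int {a M : ℝ} (ha : 0 < a) {g : ℝ → ℝ} (hg : Measurable g) (hb : ∀ y, |g y| ≤ M) (x : ℝ) :
    IntegrableOn (fun t => a * Real.exp (-a * t) * g t) (Ioi x) := by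
  refine ((integrableOn_exp_mul_Ioi (a := -a) (by linarith) x).const_mul a).mul_bdd (c := M) ?_ ?_
  · exact hg.aestronglyMeasurable
  · exact Eventually.of_forall fun t => hb _

lemma Eop_eq {a : ℝ} (g : ℝ → ℝ) (x : ℝ) :
    Eop a g x = Real.exp (a * x) * ∫ t in Ioi x, a * Real.exp (-a * t) * g t := by
  have h := (measurePreserving_add_left volume x).setIntegral_preimage_emb
    (measurableEmbedding_addLeft x) (fun t => a * Real.exp (-a * t) * g t) (Ioi x)
  rw [← h, ← integral_const_mul]
  unfold Eop
  have : (fun t => x + t) ⁻¹' Ioi x = Ioi 0 := by ext t; simp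
  rw [this]
  congr 1
  ext t
  have : Real.exp (-a * t) = Real.exp (a * x) * Real.exp (-a * (x + t)) := by
    rw [← Real.exp_add]; congr 1; ring
  rw [this]; ring

lemma Eop_lip {a M : ℝ} (ha : 0 < a) {g : ℝ → ℝ} (hg : Measurable g) (hanti : Antitone g)
    (h0 : ∀ y, 0 ≤ g y) (hM : ∀ y, g y ≤ M) {x y : ℝ} (hxy : x ≤ y) :
    |Eop a g x - Eop a g y| ≤ a * M * (y - x) := by
  have hb : ∀ y, |g y| ≤ M := fun y => abs_le.2 ⟨by linarith [h0 y, hM y], hM y⟩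
  have hle : Eop a g y ≤ Eop a g x :=
    Eop_mono' ha (Eop_int ha hg hb y) (Eop_int ha hg hb x) (fun t => hanti (by linarith))
  rw [abs_of_nonneg (by linarith), Eop_eq, Eop_eq]
  set P := ∫ t in Ioi x, a * Real.exp (-a * t) * g t with hP
  set Q := ∫ t in Ioi y, a * Real.exp (-a * t) * g t with hQ
  have hQ0 : 0 ≤ Q := integral_nonneg fun t => by
    have := h0 t
    simp only [Pi.zero_apply]; positivity
  have hPQ : P - Q = ∫ t in x..y, a * Real.exp (-a * t) * g t :=
    intervalIntegral.integral_Ioi_sub_Ioi (Phi_int ha hg hb x) hxy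
  have hbd : |P - Q| ≤ (a * Real.exp (-a * x) * M) * |y - x| := by
    rw [hPQ, ← Real.norm_eq_abs]
    refine intervalIntegral.norm_integral_le_of_norm_le_const fun t ht => ?_
    rw [uIoc_of_le hxy] at ht
    rw [norm_mul, Real.norm_of_nonneg (by positivity)]
    refine mul_le_mul ?_ (hb t) (abs_nonneg _) (by positivity)
    refine mul_le_mul_of_nonneg_left (Real.exp_le_exp.2 ?_) ha.le
    nlinarith [ht.1]
  rw [abs_of_nonneg (by linarith : 0 ≤ y - x)] at hbd
  have h1 : Real.exp (a * x) * Q ≤ Real.exp (a * y) * Q :=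
    mul_le_mul_of_nonneg_right (Real.exp_le_exp.2 (by nlinarith)) hQ0
  have h2 : Real.exp (a * x) * (P - Q) ≤ Real.exp (a * x) * ((a * Real.exp (-a * x) * M) * (y - x)) :=
    mul_le_mul_of_nonneg_left ((le_abs_self _).trans hbd) (by positivity)
  have h3 : Real.exp (a * x) * Real.exp (-a * x) = 1 := by
    rw [← Real.exp_add]; simp
  have h4 : Real.exp (a * x) * ((a * Real.exp (-a * x) * M) * (y - x)) = a * M * (y - x) := by
    linear_combination (a * M * (y - x)) * h3
  linarith

lemma Eop_deriv {a M : ℝ} (ha : 0 < a) {g : ℝ → ℝ} (hg : Continuous g) (hb : ∀ y, |g y| ≤ M)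
    (x : ℝ) : HasDerivAt (Eop a g) (a * (Eop a g x - g x)) x := by
  set k : ℝ → ℝ := fun t => a * Real.exp (-a * t) * g t with hk
  have hkc : Continuous k := by fun_prop
  have e : Eop a g = fun x => Real.exp (a * x) * ((∫ t in Ioi (0:ℝ), k t) - ∫ t in (0:ℝ)..x, k t) := by
    ext x
    rw [Eop_eq, ← intervalIntegral.integral_Ioi_sub_Ioi' (Phi_int ha hg.measurable hb 0)
      (Phi_int ha hg.measurable hb x)]
    simp only [hk]; ring
  have h1 : HasDerivAt (fun x => ∫ t in (0:ℝ)..x, k t) (k x) x :=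
    hkc.integral_hasStrictDerivAt 0 x |>.hasDerivAt
  have h2 : HasDerivAt (fun x => Real.exp (a * x)) (Real.exp (a * x) * (a * 1)) x :=
    ((hasDerivAt_id x).const_mul a).exp
  have h3 := h2.mul (h1.const_sub (∫ t in Ioi (0:ℝ), k t))
  rw [e]
  have h4 : Real.exp (a * x) * Real.exp (-a * x) = 1 := by
    rw [← Real.exp_add]; simp
  have h5 : k x = a * Real.exp (-a * x) * g x := rfl
  refine HasDerivAt.congr_deriv h3 ?_
  rw [h5]
  linear_combination (-a * g x) * h4

noncomputable def hfun (τ η lam s₀ p q r : ℝ) : ℝ :=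
  (s₀ * (1 - Real.exp (-τ * p)) + lam * (q + r)) / (η + 2 * lam)

noncomputable def Hop (τ η lam s₀ : ℝ) (u : ℝ → ℝ) (x : ℝ) : ℝ :=
  hfun τ η lam s₀ (u x) (u (x - 1)) (u (x + 1))

lemma hfun_mono {τ η lam s₀ p q r p' q' r' : ℝ} (hτ : 0 < τ) (hη : 0 < η) (hlam : 0 < lam)
    (hs : 0 < s₀) (hp : p ≤ p') (hq : q ≤ q') (hr : r ≤ r') :
    hfun τ η lam s₀ p q r ≤ hfun τ η lam s₀ p' q' r' := by
  unfold hfun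
  have : Real.exp (-τ * p') ≤ Real.exp (-τ * p) := Real.exp_le_exp.2 (by nlinarith)
  gcongr

lemma hfun_diag {τ η lam s₀ : ℝ} (hη : 0 < η) (hlam : 0 < lam) (v : ℝ) :
    hfun τ η lam s₀ v v v = v + fSIR τ η s₀ v / (η + 2 * lam) := by
  unfold hfun fSIR
  field_simp
  ring

lemma fpos {τ η s₀ I : ℝ} (hτ : 0 < τ) (hs : 0 < s₀) (hI : 0 < I)
    (h0 : fSIR τ η s₀ I = 0) {v : ℝ} (hv : 0 < v) (hvI : v < I) : 0 < fSIR τ η s₀ v := by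
  have hne : (0:ℝ) ≠ -τ * I := by
    have : 0 < τ * I := by positivity
    linarith
  have h := strictConvexOn_exp.2 (mem_univ (0:ℝ)) (mem_univ (-τ * I)) hne
    (show 0 < 1 - v / I by rw [sub_pos, div_lt_one hI]; exact hvI)
    (show 0 < v / I by positivity) (by ring)
  simp only [smul_eq_mul, mul_zero, zero_add, Real.exp_zero, mul_one] at h
  have e : v / I * (-τ * I) = -τ * v := by field_simp
  rw [e] at h
  unfold fSIR at *
  have h2 : s₀ * Real.exp (-τ * v) < s₀ * (1 - v / I + v / I * Real.exp (-τ * I)) :=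
    mul_lt_mul_of_pos_left h hs
  have h3 : (v / I) * (s₀ * (1 - Real.exp (-τ * I)) - η * I) = 0 := by rw [h0]; ring
  have h4 : η * (v / I * I) = η * v := by field_simp
  linarith

def Dcl (I : ℝ) (u : ℝ → ℝ) : Prop := Antitone u ∧ (∀ x, 0 ≤ u x) ∧ (∀ x, u x ≤ I)

noncomputable def Top' (τ η lam s₀ a : ℝ) (u : ℝ → ℝ) : ℝ → ℝ := Eop a (Hop τ η lam s₀ u)

section
variable {τ η lam s₀ a I : ℝ}

lemma Dcl.abs {u : ℝ → ℝ} (h : Dcl I u) (x : ℝ) : |u x| ≤ I :=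
  abs_le.2 ⟨by linarith [h.2.1 x, h.2.2 x], h.2.2 x⟩

lemma Hop_D (hτ : 0 < τ) (hη : 0 < η) (hlam : 0 < lam) (hs : 0 < s₀)
    (h0 : fSIR τ η s₀ I = 0) {u : ℝ → ℝ} (hu : Dcl I u) : Dcl I (Hop τ η lam s₀ u) := by
  obtain ⟨h1, h2, h3⟩ := hu
  refine ⟨fun x y hxy => ?_, fun x => ?_, fun x => ?_⟩
  · exact hfun_mono hτ hη hlam hs (h1 hxy) (h1 (by linarith)) (h1 (by linarith))
  · have := hfun_mono hτ hη hlam hs (h2 x) (h2 (x-1)) (h2 (x+1))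
    have e : hfun τ η lam s₀ 0 0 0 = 0 := by simp [hfun]
    rw [e] at this; exact this
  · have := hfun_mono hτ hη hlam hs (h3 x) (h3 (x-1)) (h3 (x+1))
    rw [hfun_diag hη hlam, h0, zero_div, add_zero] at this
    exact this

lemma T_mono (ha : 0 < a) (hτ : 0 < τ) (hη : 0 < η) (hlam : 0 < lam) (hs : 0 < s₀)
    (h0 : fSIR τ η s₀ I = 0) {u v : ℝ → ℝ} (hu : Dcl I u) (hv : Dcl I v) {x y : ℝ}
    (h : ∀ t, u (x + t) ≤ v (y + t)) : Top' τ η lam s₀ a u x ≤ Top' τ η lam s₀ a v y := by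
  have Hu := Hop_D hτ hη hlam hs h0 hu
  have Hv := Hop_D hτ hη hlam hs h0 hv
  refine Eop_mono' ha (Eop_int ha Hu.1.measurable Hu.abs x) (Eop_int ha Hv.1.measurable Hv.abs y) ?_
  intro t
  refine hfun_mono hτ hη hlam hs (h t) ?_ ?_
  · have := h (t - 1); simpa only [add_sub_assoc] using this
  · have := h (t + 1); simpa only [add_assoc] using this

lemma T_D (ha : 0 < a) (hτ : 0 < τ) (hη : 0 < η) (hlam : 0 < lam) (hs : 0 < s₀)
    (h0 : fSIR τ η s₀ I = 0) {u : ℝ → ℝ} (hu : Dcl I u) : Dcl I (Top' τ η lam s₀ a u) := by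
  have Hu := Hop_D hτ hη hlam hs h0 hu
  have Hi := fun x => Eop_int ha Hu.1.measurable Hu.abs x
  refine ⟨fun x y hxy => T_mono ha hτ hη hlam hs h0 hu hu fun t => hu.1 (by linarith),
    fun x => ?_, fun x => ?_⟩
  · rw [← Eop_const ha 0 x]
    exact Eop_mono' ha (by simp) (Hi x) fun t => Hu.2.1 _
  · rw [← Eop_const ha I x]
    exact Eop_mono' ha (Hi x) ((kernel_int ha).mul_const I) fun t => Hu.2.2 _

lemma Hop_cont {u : ℝ → ℝ} (hu : Continuous u) : Continuous (Hop τ η lam s₀ u) := by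
  unfold Hop hfun; fun_prop

lemma hfun_tendsto {ι : Type*} {l : Filter ι} {p q r : ι → ℝ} {P Q R : ℝ}
    (hp : Tendsto p l (𝓝 P)) (hq : Tendsto q l (𝓝 Q)) (hr : Tendsto r l (𝓝 R)) :
    Tendsto (fun i => hfun τ η lam s₀ (p i) (q i) (r i)) l (𝓝 (hfun τ η lam s₀ P Q R)) := by
  exact ((((hp.const_mul (-τ)).rexp).const_sub 1).const_mul s₀).add ((hq.add hr).const_mul lam)
    |>.div_const (η + 2 * lam)

lemma T_lim (ha : 0 < a) (hτ : 0 < τ) (hη : 0 < η) (hlam : 0 < lam) (hs : 0 < s₀)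
    (h0 : fSIR τ η s₀ I = 0) {u : ℝ → ℝ} (hu : Dcl I u) {l : Filter ℝ} [l.IsCountablyGenerated]
    (hl : ∀ t, Tendsto (fun x => x + t) l l) {L : ℝ} (hL : Tendsto u l (𝓝 L)) :
    Tendsto (Top' τ η lam s₀ a u) l (𝓝 (L + fSIR τ η s₀ L / (η + 2 * lam))) := by
  have Hu := Hop_D hτ hη hlam hs h0 hu
  rw [← hfun_diag hη hlam, ← Eop_const ha (hfun τ η lam s₀ L L L) 0]
  refine Eop_tendsto ha (fun _ => Hop τ η lam s₀ u) id _ 0 (fun _ => Hu.1.measurable)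
    (fun _ => Hu.abs) fun t => ?_
  refine hfun_tendsto (hL.comp (hl t)) ?_ ?_
  · have := hL.comp (hl (t - 1)); simpa only [add_sub_assoc, id, Function.comp_def] using this
  · have := hL.comp (hl (t + 1)); simpa only [add_assoc, id, Function.comp_def] using this

lemma super_sol {c γ ε : ℝ} (hc : 0 < c) (ha : a = (η + 2 * lam) / c)
    (hτ : 0 < τ) (hη : 0 < η) (hlam : 0 < lam) (hs : 0 < s₀) (hγ : 0 < γ) (hε : 0 < ε)
    (hcγ : s₀ * τ - η + lam * (Real.exp (-γ) - 2 + Real.exp γ) ≤ c * γ)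
    (hI : 0 < I) (h0 : fSIR τ η s₀ I = 0) :
    Dcl I (fun x => min I (ε * Real.exp (-γ * x))) ∧
    ∀ x, Top' τ η lam s₀ a (fun x => min I (ε * Real.exp (-γ * x))) x
      ≤ min I (ε * Real.exp (-γ * x)) := by
  have ha0 : 0 < a := by rw [ha]; positivity
  have hD : Dcl I (fun x => min I (ε * Real.exp (-γ * x))) := by
    refine ⟨fun x y hxy => ?_, fun x => ?_, fun x => min_le_left _ _⟩
    · have : Real.exp (-γ * y) ≤ Real.exp (-γ * x) := Real.exp_le_exp.2 (by nlinarith)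
      dsimp only
      gcongr
    · exact le_min hI.le (by positivity)
  refine ⟨hD, fun x => le_min ((T_D ha0 hτ hη hlam hs h0 hD).2.2 x) ?_⟩
  have Hu := Hop_D hτ hη hlam hs h0 hD
  have hμ : 0 < η + 2 * lam := by positivity
  set K := ε * ((η + 2 * lam + c * γ) / (η + 2 * lam)) with hK
  have key : ∀ y, Hop τ η lam s₀ (fun x => min I (ε * Real.exp (-γ * x))) y
      ≤ K * Real.exp (-γ * y) := by
    intro y
    refine (hfun_mono hτ hη hlam hs (min_le_right _ _) (min_le_right _ _) (min_le_right _ _)).trans ?_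
    unfold hfun
    have e1 : Real.exp (-γ * (y - 1)) = Real.exp (-γ * y) * Real.exp γ := by
      rw [← Real.exp_add]; congr 1; ring
    have e2 : Real.exp (-γ * (y + 1)) = Real.exp (-γ * y) * Real.exp (-γ) := by
      rw [← Real.exp_add]; congr 1; ring
    rw [e1, e2, hK, div_le_iff₀ hμ]
    set w := Real.exp (-γ * y) with hw
    have hw0 : 0 < w := Real.exp_pos _
    have h1 := Real.add_one_le_exp (-τ * (ε * w))
    have h2 : s₀ * (1 - Real.exp (-τ * (ε * w))) ≤ s₀ * (τ * (ε * w)) :=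
      mul_le_mul_of_nonneg_left (by linarith) hs.le
    have h3 := mul_le_mul_of_nonneg_left hcγ (by positivity : 0 ≤ ε * w)
    have h4 : ε * ((η + 2 * lam + c * γ) / (η + 2 * lam)) * w * (η + 2 * lam)
      = ε * w * (η + 2 * lam + c * γ) := by field_simp
    rw [h4]
    linarith
  have h5 : Top' τ η lam s₀ a (fun x => min I (ε * Real.exp (-γ * x))) x
      ≤ Eop a (fun y => K * Real.exp (-γ * y)) x :=
    Eop_mono' ha0 (Eop_int ha0 Hu.1.measurable Hu.abs x) (exp_int' ha0 hγ.le x) fun t => key _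
  refine h5.trans (le_of_eq ?_)
  rw [Eop_exp ha0 hγ.le, hK, ha]
  field_simp

lemma phi_props {γ ε : ℝ} (hγ : 0 < γ) (hε : 0 < ε) :
    ∃ φ : ℝ → ℝ, Antitone φ ∧ (∀ x, 0 ≤ φ x) ∧ (∀ x, φ x ≤ ε) ∧ (∀ x, x ≤ 0 → φ x = ε) ∧
      (∀ x, φ x ≤ ε * Real.exp (-γ * x)) ∧ (∀ x y, x ≤ y → |φ x - φ y| ≤ ε * γ * (y - x)) := by
  have hm : Antitone fun x : ℝ => ε * max 0 (min 1 (1 - γ * x)) := by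
    intro x y hxy
    have : 1 - γ * y ≤ 1 - γ * x := by nlinarith
    dsimp only
    gcongr
  refine ⟨fun x => ε * max 0 (min 1 (1 - γ * x)), hm, ?_, ?_, ?_, ?_, ?_⟩
  · intro x; positivity
  · intro x
    have : max 0 (min 1 (1 - γ * x)) ≤ 1 := max_le zero_le_one (min_le_left _ _)
    dsimp only; nlinarith
  · intro x hx
    have h1 : min 1 (1 - γ * x) = 1 := min_eq_left (by nlinarith)
    simp [h1]
  · intro x
    refine mul_le_mul_of_nonneg_left (max_le (Real.exp_pos _).le ((min_le_right _ _).trans ?_)) hε.le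
    have := Real.add_one_le_exp (-γ * x)
    linarith
  · intro x y hxy
    rw [abs_of_nonneg (sub_nonneg.2 (hm hxy))]
    dsimp only
    rw [← mul_sub, mul_assoc]
    refine mul_le_mul_of_nonneg_left ?_ hε.le
    have : 0 ≤ γ * (y - x) := mul_nonneg hγ.le (by linarith)
    rw [sub_le_iff_le_add]
    refine max_le ?_ ?_
    · have := le_max_left 0 (min 1 (1 - γ * y)); linarith
    · have h1 := le_max_right 0 (min 1 (1 - γ * y))
      rcases le_total 1 (1 - γ * y) with h | h
      · rw [min_eq_left h] at h1 ⊢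
        have := min_le_left 1 (1 - γ * x); linarith
      · rw [min_eq_right h] at h1 ⊢
        have := min_le_right 1 (1 - γ * x); linarith

lemma approx {c γ ε : ℝ} (hc : 0 < c) (ha : a = (η + 2 * lam) / c)
    (hτ : 0 < τ) (hη : 0 < η) (hlam : 0 < lam) (hs : 0 < s₀) (hγ : 0 < γ) (hε : 0 < ε)
    (hcγ : s₀ * τ - η + lam * (Real.exp (-γ) - 2 + Real.exp γ) ≤ c * γ)
    (hI : 0 < I) (h0 : fSIR τ η s₀ I = 0) (hεI : ε ≤ I / 2) :
    ∃ u : ℝ → ℝ, Dcl I u ∧ u 0 = I / 2 ∧ (∀ x, |u x - Top' τ η lam s₀ a u x| ≤ ε) ∧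
      ∀ x y, x ≤ y → |u x - u y| ≤ (a * I + I * γ) * (y - x) := by
  have ha0 : 0 < a := by rw [ha]; positivity
  have hμ : 0 < η + 2 * lam := by positivity
  obtain ⟨φ, φm, φ0, φε, φe, φs, φl⟩ := phi_props hγ hε
  set T := Top' τ η lam s₀ a with hT
  set A : Set (ℝ → ℝ) := {u | Dcl I u ∧ ∀ x, φ x ≤ u x ∧ T u x ≤ u x} with hA
  obtain ⟨pD, pT⟩ := super_sol hc ha hτ hη hlam hs hγ hε hcγ hI h0
  set p : ℝ → ℝ := fun x => min I (ε * Real.exp (-γ * x)) with hp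
  have pA : p ∈ A := ⟨pD, fun x => ⟨le_min ((φε x).trans (by linarith)) (φs x), pT x⟩⟩
  have : Nonempty A := ⟨⟨p, pA⟩⟩
  set J : ℝ → ℝ := fun x => ⨅ u : A, u.1 x with hJ
  have bdd : ∀ x, BddBelow (range fun u : A => u.1 x) := fun x =>
    ⟨0, by rintro _ ⟨u, rfl⟩; exact u.2.1.2.1 x⟩
  have Jle : ∀ u ∈ A, ∀ x, J x ≤ u x := fun u hu x => ciInf_le (bdd x) ⟨u, hu⟩
  have JD : Dcl I J := by
    refine ⟨fun x y hxy => ?_, fun x => ?_, fun x => (Jle p pA x).trans (pD.2.2 x)⟩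
    · exact le_ciInf fun u => (Jle u.1 u.2 y).trans (u.2.1.1 hxy)
    · exact le_ciInf fun u => u.2.1.2.1 x
  have JA : J ∈ A := by
    refine ⟨JD, fun x => ⟨le_ciInf fun u => (u.2.2 x).1, le_ciInf fun u => ?_⟩⟩
    exact (T_mono ha0 hτ hη hlam hs h0 JD u.2.1 fun t => Jle u.1 u.2 _).trans (u.2.2 x).2
  have TD := T_D ha0 hτ hη hlam hs h0 JD
  have hmax : ∀ x, J x = max (T J x) (φ x) := by
    intro x
    refine le_antisymm ?_ (max_le (JA.2 x).2 (JA.2 x).1)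
    have vD : Dcl I (fun x => max (T J x) (φ x)) :=
      ⟨fun x y hxy => max_le_max (TD.1 hxy) (φm hxy), fun x => (φ0 x).trans (le_max_right _ _),
        fun x => max_le (TD.2.2 x) ((φε x).trans (by linarith))⟩
    refine Jle (fun x => max (T J x) (φ x)) ⟨vD, fun x => ⟨le_max_right _ _, ?_⟩⟩ x
    refine le_trans ?_ (le_max_left _ _)
    exact T_mono ha0 hτ hη hlam hs h0 vD JD fun t => max_le (JA.2 _).2 (JA.2 _).1
  have HJ := Hop_D hτ hη hlam hs h0 JD
  have hlip : ∀ x y, x ≤ y → |J x - J y| ≤ (a * I + I * γ) * (y - x) := by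
    intro x y hxy
    rw [hmax x, hmax y]
    refine (abs_max_sub_max_le_max _ _ _ _).trans (max_le ?_ ?_)
    · refine (Eop_lip ha0 HJ.1.measurable HJ.1 HJ.2.1 HJ.2.2 hxy).trans ?_
      exact mul_le_mul_of_nonneg_right (by nlinarith) (by linarith)
    · refine (φl x y hxy).trans ?_
      refine mul_le_mul_of_nonneg_right ?_ (by linarith)
      have : 0 < a * I := by positivity
      nlinarith
  have hlip' : ∀ x y, |J x - J y| ≤ (a * I + I * γ) * |x - y| := by
    intro x y
    rcases le_total x y with h | h
    · rw [abs_of_nonpos (by linarith : x - y ≤ 0)]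
      have := hlip x y h; linarith
    · rw [abs_of_nonneg (by linarith : 0 ≤ x - y), abs_sub_comm]
      exact hlip y x h
  have hcont : Continuous J := by
    refine (LipschitzWith.of_dist_le_mul (K := (a * I + I * γ).toNNReal) fun x y => ?_).continuous
    rw [Real.dist_eq, Real.dist_eq, Real.coe_toNNReal _ (by positivity)]
    exact hlip' x y
  have happ : ∀ x, |J x - T J x| ≤ ε := by
    intro x
    rw [abs_of_nonneg (sub_nonneg.2 (JA.2 x).2), sub_le_iff_le_add, hmax x]
    have := TD.2.1 x
    exact max_le (by linarith) (by linarith [φε x])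
  -- limit at minus infinity
  have hbddA : BddAbove (range J) := ⟨I, by rintro _ ⟨x, rfl⟩; exact JD.2.2 x⟩
  have hlim := tendsto_atBot_ciSup JD.1 hbddA
  set L := ⨆ x, J x with hL
  have hLε : ε ≤ L := by
    have h1 := (JA.2 0).1
    rw [φe 0 le_rfl] at h1
    exact h1.trans (le_ciSup hbddA 0)
  have hTl := T_lim ha0 hτ hη hlam hs h0 JD
    (fun t => tendsto_atBot_add_const_right atBot t tendsto_id) hlim
  have hfL : fSIR τ η s₀ L ≤ 0 := by
    have := le_of_tendsto_of_tendsto' hTl hlim fun x => (JA.2 x).2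
    have h2 : fSIR τ η s₀ L / (η + 2 * lam) ≤ 0 := by linarith
    by_contra hcon
    push Not at hcon
    have := div_pos hcon hμ
    linarith
  have hLI : I ≤ L := by
    by_contra hcon
    push Not at hcon
    have := fpos hτ hs hI h0 (by linarith : 0 < L) hcon
    linarith
  have hJ0 : J 0 ≤ I / 2 := by
    have h1 := (Jle p pA 0).trans (min_le_right _ _)
    simp at h1
    linarith
  obtain ⟨z, hz⟩ : ∃ z, J z = I / 2 := by
    obtain ⟨w, hw⟩ := (hlim.eventually (lt_mem_nhds (by linarith : I / 2 < L))).exists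
    exact mem_range_of_exists_le_of_exists_ge hcont ⟨0, hJ0⟩ ⟨w, hw.le⟩
  refine ⟨fun x => J (x + z), ⟨fun x y h => JD.1 (by linarith), fun x => JD.2.1 _,
    fun x => JD.2.2 _⟩, by simpa using hz, fun x => ?_, fun x y hxy => ?_⟩
  · have e : Top' τ η lam s₀ a (fun x => J (x + z)) x = T J (x + z) := by
      simp only [hT, Top', Eop, Hop]
      congr 1
      ext t
      have e1 : x + t + z = x + z + t := by ring
      have e2 : x + t - 1 + z = x + z + t - 1 := by ring
      have e3 : x + t + 1 + z = x + z + t + 1 := by ring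
      rw [e1, e2, e3]
    change |J (x + z) - Top' τ η lam s₀ a (fun x => J (x + z)) x| ≤ ε
    rw [e]
    exact happ _
  · have := hlip (x + z) (y + z) (by linarith)
    simpa using this

lemma profile {c γ : ℝ} (hc : 0 < c) (ha : a = (η + 2 * lam) / c)
    (hτ : 0 < τ) (hη : 0 < η) (hlam : 0 < lam) (hs : 0 < s₀) (hγ : 0 < γ)
    (hcγ : s₀ * τ - η + lam * (Real.exp (-γ) - 2 + Real.exp γ) ≤ c * γ)
    (hI : 0 < I) (h0 : fSIR τ η s₀ I = 0) :
    ∃ u : ℝ → ℝ, Dcl I u ∧ u 0 = I / 2 ∧ (∀ x, u x = Top' τ η lam s₀ a u x) ∧ Continuous u := by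
  have ha0 : 0 < a := by rw [ha]; positivity
  have hex : ∀ n : ℕ, ∃ u : ℝ → ℝ, Dcl I u ∧ u 0 = I / 2 ∧
      (∀ x, |u x - Top' τ η lam s₀ a u x| ≤ I / 2 / ((n:ℝ) + 1)) ∧
      ∀ x y, x ≤ y → |u x - u y| ≤ (a * I + I * γ) * (y - x) := fun n =>
    approx hc ha hτ hη hlam hs hγ (by positivity) hcγ hI h0
      (div_le_self (by positivity) (by linarith [(Nat.cast_nonneg n : (0:ℝ) ≤ n)]))
  choose u uD u0 uT ul using hex
  set C := a * I + I * γ with hC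
  have hC0 : 0 < C := by positivity
  obtain ⟨q, ψ, hψ, hq⟩ := CompactSpace.tendsto_subseq
    (fun n => (fun r : ℚ => (⟨u n r, (uD n).2.1 _, (uD n).2.2 _⟩ : Icc (0:ℝ) I)))
  have hq' : ∀ r : ℚ, Tendsto (fun n => u (ψ n) r) atTop (𝓝 (q r : ℝ)) := by
    intro r
    have h1 := (tendsto_pi_nhds.1 hq) r
    exact (continuous_subtype_val.tendsto _).comp h1
  have hconv : ∀ x : ℝ, ∃ L, Tendsto (fun n => u (ψ n) x) atTop (𝓝 L) := by
    intro x
    apply cauchySeq_tendsto_of_complete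
    rw [Metric.cauchySeq_iff]
    intro e he
    obtain ⟨r, hr1, hr2⟩ := exists_rat_btwn (show x < x + e / (3 * C) by
      have : 0 < e / (3 * C) := by positivity
      linarith)
    obtain ⟨N, hN⟩ := (Metric.cauchySeq_iff.1 (hq' r).cauchySeq) (e / 3) (by positivity)
    refine ⟨N, fun m hm n hn => ?_⟩
    have h1 := hN m hm n hn
    rw [Real.dist_eq] at h1 ⊢
    have hb : C * (r - x) < e / 3 := by
      have : C * (r - x) < C * (e / (3 * C)) := mul_lt_mul_of_pos_left (by linarith) hC0
      have e1 : C * (e / (3 * C)) = e / 3 := by field_simp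
      linarith
    have h2 := ul (ψ m) x r hr1.le
    have h3 := ul (ψ n) x r hr1.le
    rw [abs_le] at h2 h3
    rw [abs_lt] at h1 ⊢
    constructor <;> linarith
  choose v hv using hconv
  have vD : Dcl I v := by
    refine ⟨fun x y hxy => ?_, fun x => ?_, fun x => ?_⟩
    · exact le_of_tendsto_of_tendsto' (hv y) (hv x) fun n => (uD _).1 hxy
    · exact ge_of_tendsto' (hv x) fun n => (uD _).2.1 x
    · exact le_of_tendsto' (hv x) fun n => (uD _).2.2 x
  have vl : ∀ x y, x ≤ y → |v x - v y| ≤ C * (y - x) := fun x y hxy =>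
    le_of_tendsto' ((hv x).sub (hv y)).abs fun n => ul _ x y hxy
  have hvcont : Continuous v := by
    refine (LipschitzWith.of_dist_le_mul (K := C.toNNReal) fun x y => ?_).continuous
    rw [Real.dist_eq, Real.dist_eq, Real.coe_toNNReal _ (by positivity)]
    rcases le_total x y with h | h
    · rw [abs_of_nonpos (by linarith : x - y ≤ 0)]
      have := vl x y h; linarith
    · rw [abs_of_nonneg (by linarith : 0 ≤ x - y), abs_sub_comm]
      exact vl y x h
  refine ⟨v, vD, ?_, fun x => ?_, hvcont⟩
  · refine tendsto_nhds_unique (hv 0) ?_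
    simp only [u0]
    exact tendsto_const_nhds
  · have HD := fun n => Hop_D hτ hη hlam hs h0 (uD n)
    have h1 : Tendsto (fun n => Top' τ η lam s₀ a (u (ψ n)) x) atTop (𝓝 (Top' τ η lam s₀ a v x)) :=
      Eop_tendsto ha0 (fun n => Hop τ η lam s₀ (u (ψ n))) (fun _ => x) _ x
        (fun n => (HD _).1.measurable) (fun n => (HD _).abs)
        fun t => hfun_tendsto (hv _) (hv _) (hv _)
    have h2 : Tendsto (fun n => |u (ψ n) x - Top' τ η lam s₀ a (u (ψ n)) x|) atTop
      (𝓝 |v x - Top' τ η lam s₀ a v x|) := ((hv x).sub h1).abs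
    have h3 : Tendsto (fun n : ℕ => I / 2 / ((ψ n : ℝ) + 1)) atTop (𝓝 0) := by
      have : Tendsto (fun n : ℕ => I / 2 / ((n : ℝ) + 1)) atTop (𝓝 0) :=
        tendsto_const_nhds.div_atTop
          (tendsto_atTop_add_const_right _ _ tendsto_natCast_atTop_atTop)
      exact this.comp hψ.tendsto_atTop
    have h4 := le_of_tendsto_of_tendsto' h2 h3 fun n => uT (ψ n) x
    have h5 := abs_nonpos_iff.1 h4
    linarith

end

lemma smooth_of_eq {τ η lam s₀ a : ℝ} {u : ℝ → ℝ} (hc : Continuous u)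
    (hd : ∀ x, HasDerivAt u (a * (u x - Hop τ η lam s₀ u x)) x) : ContDiff ℝ (⊤ : ℕ∞) u := by
  have hder : deriv u = fun x => a * (u x - Hop τ η lam s₀ u x) := funext fun x => (hd x).deriv
  rw [contDiff_infty]
  intro n
  induction n with
  | zero => exact contDiff_zero.2 hc
  | succ n ih =>
    push_cast
    rw [contDiff_succ_iff_deriv]
    refine ⟨fun x => (hd x).differentiableAt, by simp, ?_⟩
    rw [hder]
    unfold Hop hfun
    have h1 : ContDiff ℝ n fun x => u (x - 1) := ih.comp (contDiff_id.sub contDiff_const)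
    have h2 : ContDiff ℝ n fun x => u (x + 1) := ih.comp (contDiff_id.add contDiff_const)
    have h3 : ContDiff ℝ n fun x => Real.exp (-τ * u x) := (contDiff_const.mul ih).exp
    exact contDiff_const.mul (ih.sub
      (((contDiff_const.mul (contDiff_const.sub h3)).add (contDiff_const.mul (h1.add h2))).div_const _))

/-- If `u` is differentiable, shifted differences. -/
lemma part_one {τ η lam s₀ I c γ : ℝ} (hc : 0 < c)
    (hτ : 0 < τ) (hη : 0 < η) (hlam : 0 < lam) (hs : 0 < s₀) (hγ : 0 < γ)
    (hcγ : s₀ * τ - η + lam * (Real.exp (-γ) - 2 + Real.exp γ) ≤ c * γ)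
    (hI : 0 < I) (h0 : fSIR τ η s₀ I = 0)
    (huniq : ∀ v : ℝ, 0 < v → fSIR τ η s₀ v = 0 → v = I) :
    ∃ S J : ℝ → ℝ, IsTravelingWave τ η lam s₀ c S J := by
  obtain ⟨a, ha⟩ : ∃ a, a = (η + 2 * lam) / c := ⟨_, rfl⟩
  have ha0 : 0 < a := by rw [ha]; positivity
  have hμ : 0 < η + 2 * lam := by positivity
  obtain ⟨u, uD, u0, uT, uc⟩ := profile hc ha hτ hη hlam hs hγ hcγ hI h0
  have HD := Hop_D hτ hη hlam hs h0 uD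
  have hd : ∀ x, HasDerivAt u (a * (u x - Hop τ η lam s₀ u x)) x := by
    intro x
    have h1 := Eop_deriv ha0 (Hop_cont (τ := τ) (η := η) (lam := lam) (s₀ := s₀) uc) HD.abs x
    have e : Eop a (Hop τ η lam s₀ u) = u := funext fun x => (uT x).symm
    rwa [e] at h1
  have hsm := smooth_of_eq uc hd
  obtain ⟨J, hJ⟩ : ∃ J : ℝ → ℝ, J = fun x => fSIR τ η s₀ (u x) +
    lam * (u (x - 1) - 2 * u x + u (x + 1)) := ⟨_, rfl⟩
  have hJd : ∀ x, HasDerivAt u (-J x / c) x := by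
    intro x
    refine (hd x).congr_deriv ?_
    rw [hJ, ha]
    simp only [Hop, hfun, fSIR]
    field_simp
    ring
  have hJn : ∀ x, 0 ≤ J x := by
    intro x
    have h1 : deriv u x ≤ 0 := uD.1.deriv_nonpos
    rw [(hJd x).deriv, div_le_iff₀ hc] at h1
    linarith
  have hum : ∀ x, HasDerivAt (fun x => u (x - 1)) (-J (x - 1) / c) x := fun x =>
    (hJd (x - 1)).comp_sub_const x 1
  have hup : ∀ x, HasDerivAt (fun x => u (x + 1)) (-J (x + 1) / c) x := fun x =>
    (hJd (x + 1)).comp_add_const x 1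
  have hexp : ∀ x, HasDerivAt (fun x => Real.exp (-τ * u x))
      (Real.exp (-τ * u x) * (-τ * (-J x / c))) x := fun x => ((hJd x).const_mul (-τ)).exp
  have hJ' : ∀ x, HasDerivAt J (-(τ * (s₀ * Real.exp (-τ * u x)) * J x - η * J x +
      lam * (J (x - 1) - 2 * J x + J (x + 1))) / c) x := by
    intro x
    have h1 := ((((hexp x).const_sub 1).const_mul s₀).sub ((hJd x).const_mul η)).add
      ((((hum x).sub ((hJd x).const_mul 2)).add (hup x)).const_mul lam)
    have e : J = fun x => s₀ * (1 - Real.exp (-τ * u x)) - η * u x +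
      lam * (u (x - 1) - 2 * u x + u (x + 1)) := by rw [hJ]; rfl
    have h2 := h1.congr_deriv (g' := -(τ * (s₀ * Real.exp (-τ * u x)) * J x - η * J x +
      lam * (J (x - 1) - 2 * J x + J (x + 1))) / c) (by field_simp; ring)
    rw [show J = _ from e] at *
    exact h2
  -- limits
  have hlimits : ∀ {l : Filter ℝ} [l.IsCountablyGenerated] [l.NeBot], (∀ t, Tendsto (fun x => x + t) l l) →
      ∀ {L : ℝ}, Tendsto u l (𝓝 L) → fSIR τ η s₀ L = 0 ∧ Tendsto J l (𝓝 0) := by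
    intro l _ _ hl L hL
    have h1 := T_lim ha0 hτ hη hlam hs h0 uD hl hL
    have e : Top' τ η lam s₀ a u = u := funext fun x => (uT x).symm
    rw [e] at h1
    have h2 := tendsto_nhds_unique h1 hL
    have h3 : fSIR τ η s₀ L = 0 := by
      have : fSIR τ η s₀ L / (η + 2 * lam) = 0 := by linarith
      rcases div_eq_zero_iff.1 this with h | h
      · exact h
      · linarith
    refine ⟨h3, ?_⟩
    have h4 : Tendsto J l (𝓝 (fSIR τ η s₀ L + lam * (L - 2 * L + L))) := by
      rw [hJ]
      have hm : Tendsto (fun x => u (x - 1)) l (𝓝 L) := hL.comp (hl (-1))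
      have hp : Tendsto (fun x => u (x + 1)) l (𝓝 L) := hL.comp (hl 1)
      exact (((((hL.const_mul (-τ)).rexp).const_sub 1).const_mul s₀).sub (hL.const_mul η)).add
        (((hm.sub (hL.const_mul 2)).add hp).const_mul lam)
    rw [h3] at h4
    convert h4 using 2
    ring
  have hbA : BddAbove (range u) := ⟨I, by rintro _ ⟨x, rfl⟩; exact uD.2.2 x⟩
  have hbB : BddBelow (range u) := ⟨0, by rintro _ ⟨x, rfl⟩; exact uD.2.1 x⟩
  have hbot := tendsto_atBot_ciSup uD.1 hbA
  have htop := tendsto_atTop_ciInf uD.1 hbB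
  obtain ⟨-, Jbot⟩ := hlimits (fun t => tendsto_atBot_add_const_right atBot t tendsto_id) hbot
  obtain ⟨f0, Jtop⟩ := hlimits (fun t => tendsto_atTop_add_const_right atTop t tendsto_id) htop
  have hinf : (⨅ x, u x) = 0 := by
    have h1 : (⨅ x, u x) ≤ I / 2 := by rw [← u0]; exact ciInf_le hbB 0
    have h2 : 0 ≤ ⨅ x, u x := le_ciInf uD.2.1
    rcases h2.eq_or_lt with h | h
    · exact h.symm
    · have := huniq _ h f0
      linarith
  rw [hinf] at htop
  -- positivity of J
  have hJpos : ∀ x, 0 < J x := by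
    by_contra hcon
    push Not at hcon
    obtain ⟨x0, hx0⟩ := hcon
    have hprop : ∀ x, J x = 0 → ∀ y, x ≤ y → J y = 0 := by
      intro x hx y hxy
      have hE : ∀ z, HasDerivAt (fun z => Real.exp (-a * z))
        (Real.exp (-a * z) * (-a * 1)) z := fun z => ((hasDerivAt_id z).const_mul (-a)).exp
      have hanti : Antitone fun z => Real.exp (-a * z) * J z := by
        refine antitone_of_hasDerivAt_nonpos (fun z => (hE z).mul (hJ' z)) fun z => ?_
        have e : Real.exp (-a * z) * (-a * 1) * J z + Real.exp (-a * z) *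
          (-(τ * (s₀ * Real.exp (-τ * u z)) * J z - η * J z +
          lam * (J (z - 1) - 2 * J z + J (z + 1))) / c) =
          - (Real.exp (-a * z) / c * (τ * (s₀ * Real.exp (-τ * u z)) * J z
            + lam * (J (z - 1) + J (z + 1)))) := by
          rw [ha]; field_simp; ring
        simp only [Pi.zero_apply]
        rw [e]
        have := hJn z
        have := hJn (z - 1)
        have := hJn (z + 1)
        have : 0 ≤ (Real.exp (-a * z) / c * (τ * (s₀ * Real.exp (-τ * u z)) * J z
            + lam * (J (z - 1) + J (z + 1)))) := by positivity
        linarith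
      have h1 := hanti hxy
      simp only [hx, mul_zero] at h1
      have h2 := Real.exp_pos (-a * y)
      have h3 : J y ≤ 0 := by
        by_contra h
        push Not at h
        have := mul_pos h2 h
        linarith
      exact le_antisymm h3 (hJn y)
    have hback : ∀ x, J x = 0 → J (x - 1) = 0 := by
      intro x hx
      have hmin : IsLocalMin J x := Eventually.of_forall fun y => by rw [hx]; exact hJn y
      have h1 := hmin.hasDerivAt_eq_zero (hJ' x)
      rw [hx] at h1
      have h2 : lam * (J (x - 1) + J (x + 1)) = 0 := by
        rcases div_eq_zero_iff.1 h1 with h | h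
        · linarith
        · linarith
      have h3 : J (x - 1) + J (x + 1) = 0 := by
        rcases mul_eq_zero.1 h2 with h | h
        · linarith
        · exact h
      have := hJn (x - 1)
      have := hJn (x + 1)
      linarith
    have hall : ∀ n : ℕ, J (x0 - n) = 0 := by
      intro n
      induction n with
      | zero => simpa using le_antisymm hx0 (hJn x0)
      | succ n ih =>
        have := hback _ ih
        rw [← this]; congr 1; push_cast; ring
    have hz : ∀ x, J x = 0 := by
      intro x
      obtain ⟨n, hn⟩ := exists_nat_ge (x0 - x)
      exact hprop _ (hall n) x (by linarith)
    have hconst : ∀ x, u x = u 0 := fun x =>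
      is_const_of_deriv_eq_zero (fun x => (hJd x).differentiableAt)
        (fun x => by rw [(hJd x).deriv, hz x]; simp) x 0
    have : Tendsto u atTop (𝓝 (I / 2)) := by
      rw [show u = fun _ => I / 2 from funext fun x => (hconst x).trans u0]
      exact tendsto_const_nhds
    have := tendsto_nhds_unique this htop
    linarith
  have hstrict : StrictAnti u := strictAnti_of_hasDerivAt_neg hJd fun x =>
    div_neg_of_neg_of_pos (by linarith [hJpos x]) hc
  have hupos : ∀ x, 0 < u x := fun x =>
    (uD.2.1 (x + 1)).trans_lt (hstrict (by linarith))
  have hum_s : ContDiff ℝ (⊤ : ℕ∞) fun x => u (x - 1) := hsm.comp (contDiff_id.sub contDiff_const)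
  have hup_s : ContDiff ℝ (⊤ : ℕ∞) fun x => u (x + 1) := hsm.comp (contDiff_id.add contDiff_const)
  have hex_s : ContDiff ℝ (⊤ : ℕ∞) fun x => Real.exp (-τ * u x) := (contDiff_const.mul hsm).exp
  refine ⟨fun x => s₀ * Real.exp (-τ * u x), J, contDiff_const.mul hex_s, ?_, ?_, hJpos, ?_, ?_, ?_,
    ?_, Jtop, Jbot⟩
  · rw [hJ]
    exact ((contDiff_const.mul (contDiff_const.sub hex_s)).sub (contDiff_const.mul hsm)).add
      (contDiff_const.mul ((hum_s.sub (contDiff_const.mul hsm)).add hup_s))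
  · intro x
    refine ⟨by positivity, ?_⟩
    have : Real.exp (-τ * u x) < 1 := by
      rw [Real.exp_lt_one_iff]
      have := mul_pos hτ (hupos x)
      linarith
    nlinarith
  · refine ⟨s₀ + lam * (2 * I), fun x => ?_⟩
    rw [hJ]
    simp only [fSIR]
    have h1 := uD.2.2 (x - 1)
    have h2 := uD.2.2 (x + 1)
    have h3 := uD.2.1 x
    have h4 := Real.exp_pos (-τ * u x)
    have h5 : lam * (u (x - 1) - 2 * u x + u (x + 1)) ≤ lam * (2 * I) :=
      mul_le_mul_of_nonneg_left (by linarith) hlam.le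
    have h6 := mul_pos hs h4
    have h7 := mul_nonneg hη.le h3
    linarith
  · intro x
    rw [((hexp x).const_mul s₀).deriv]
    field_simp
  · intro x
    rw [(hJ' x).deriv]
    field_simp
  · have h1 : Tendsto (fun x => s₀ * Real.exp (-τ * u x)) atTop (𝓝 (s₀ * Real.exp (-τ * 0))) :=
      ((htop.const_mul (-τ)).rexp).const_mul s₀
    simpa using h1

lemma part_two {τ η lam s₀ I c : ℝ} (hc : 0 < c)
    (hτ : 0 < τ) (hη : 0 < η) (hs : 0 < s₀)
    (huniq : ∀ v : ℝ, 0 < v → fSIR τ η s₀ v = 0 → v = I) {S J : ℝ → ℝ}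
    (h : IsTravelingWave τ η lam s₀ c S J) :
    Tendsto S atBot (𝓝 (s₀ * Real.exp (-τ * I))) := by
  obtain ⟨hS, hJ, hSb, hJp, -, eS, eJ, hSt, hJt, hJb⟩ := h
  have dS : ∀ x, HasDerivAt S (τ * S x * J x / c) x := by
    intro x
    have h1 := (hS.differentiable (by simp) x).hasDerivAt
    refine h1.congr_deriv ?_
    rw [eq_div_iff hc.ne']
    linarith [eS x]
  have dJ : ∀ x, HasDerivAt J (-(τ * S x * J x - η * J x +
      lam * (J (x - 1) - 2 * J x + J (x + 1))) / c) x := by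
    intro x
    have h1 := (hJ.differentiable (by simp) x).hasDerivAt
    refine h1.congr_deriv ?_
    rw [eq_div_iff hc.ne']
    linarith [eJ x]
  obtain ⟨u, hu⟩ : ∃ u : ℝ → ℝ, u = fun x => (Real.log s₀ - Real.log (S x)) / τ := ⟨_, rfl⟩
  have hSu : ∀ x, S x = s₀ * Real.exp (-τ * u x) := by
    intro x
    have e : -τ * u x = Real.log (S x) - Real.log s₀ := by rw [hu]; field_simp; ring
    rw [e, Real.exp_sub, Real.exp_log hs, Real.exp_log (hSb x).1]
    field_simp
  have du : ∀ x, HasDerivAt u (-J x / c) x := by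
    intro x
    have h1 := (((dS x).log (hSb x).1.ne').const_sub (Real.log s₀)).div_const τ
    rw [hu]
    refine h1.congr_deriv ?_
    have := (hSb x).1
    field_simp
  have upos : ∀ x, 0 < u x := by
    intro x
    rw [hu]
    exact div_pos (sub_pos.2 (Real.log_lt_log (hSb x).1 (hSb x).2)) hτ
  have hanti : StrictAnti u := strictAnti_of_hasDerivAt_neg du fun x =>
    div_neg_of_neg_of_pos (by linarith [hJp x]) hc
  have hum : ∀ x, HasDerivAt (fun x => u (x - 1)) (-J (x - 1) / c) x := fun x =>
    (du (x - 1)).comp_sub_const x 1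
  have hup : ∀ x, HasDerivAt (fun x => u (x + 1)) (-J (x + 1) / c) x := fun x =>
    (du (x + 1)).comp_add_const x 1
  have hutop : Tendsto u atTop (𝓝 0) := by
    have h1 := ((hSt.log hs.ne').const_sub (Real.log s₀)).div_const τ
    rw [sub_self, zero_div] at h1
    rw [hu]; exact h1
  obtain ⟨k, hk⟩ : ∃ k : ℝ → ℝ, k = fun x => J x - ((s₀ - S x) - η * u x +
    lam * (u (x - 1) - 2 * u x + u (x + 1))) := ⟨_, rfl⟩
  have dk : ∀ x, HasDerivAt k 0 x := by
    intro x
    rw [hk]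
    refine ((dJ x).sub ((((dS x).const_sub s₀).sub ((du x).const_mul η)).add
      ((((hum x).sub ((du x).const_mul 2)).add (hup x)).const_mul lam))).congr_deriv ?_
    field_simp
    ring
  have htm : Tendsto (fun x => u (x - 1)) atTop (𝓝 0) :=
    hutop.comp (tendsto_atTop_add_const_right atTop (-1) tendsto_id)
  have htp : Tendsto (fun x => u (x + 1)) atTop (𝓝 0) :=
    hutop.comp (tendsto_atTop_add_const_right atTop 1 tendsto_id)
  have hk0 : ∀ x, k x = 0 := by
    intro x
    have hconst : ∀ y, k y = k x := fun y =>
      is_const_of_deriv_eq_zero (fun x => (dk x).differentiableAt) (fun x => (dk x).deriv) y x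
    have h1 : Tendsto k atTop (𝓝 (0 - ((s₀ - s₀) - η * 0 + lam * (0 - 2 * 0 + 0)))) := by
      rw [hk]
      exact hJt.sub (((hSt.const_sub s₀).sub (hutop.const_mul η)).add
        (((htm.sub (hutop.const_mul 2)).add htp).const_mul lam))
    have h2 : Tendsto k atTop (𝓝 (k x)) := by
      rw [show k = fun _ => k x from funext hconst]; exact tendsto_const_nhds
    have := tendsto_nhds_unique h2 h1
    rw [this]; ring
  have key : ∀ x, fSIR τ η s₀ (u x) = J x - lam * ((u (x - 1) - u x) - (u x - u (x + 1))) := by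
    intro x
    have h1 := hk0 x
    rw [hk] at h1
    simp only [fSIR]
    have h2 := hSu x
    simp only at h1
    linarith
  -- differences tend to zero
  have hdiff : Tendsto (fun x => u x - u (x + 1)) atBot (𝓝 0) := by
    rw [Metric.tendsto_nhds]
    intro e he
    obtain ⟨N, hN⟩ := eventually_atBot.1 ((Metric.tendsto_nhds.1 hJb) (e * c) (by positivity))
    refine eventually_atBot.2 ⟨N - 1, fun x hx => ?_⟩
    obtain ⟨z, hz, hzz⟩ := exists_hasDerivAt_eq_slope u (fun x => -J x / c)
      (by linarith : x < x + 1) (fun y _ => (du y).continuousAt.continuousWithinAt) (fun y _ => du y)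
    have h1 := hN z (by linarith [hz.2])
    rw [Real.dist_eq, sub_zero, abs_of_pos (hJp z)] at h1
    have h2 : u x - u (x + 1) = J z / c := by
      have : x + 1 - x = 1 := by ring
      rw [this, div_one] at hzz
      rw [neg_div] at hzz
      linarith
    rw [Real.dist_eq, sub_zero, h2, abs_of_pos (div_pos (hJp z) hc), div_lt_iff₀ hc]
    exact h1
  have hdiff' : Tendsto (fun x => u (x - 1) - u x) atBot (𝓝 0) := by
    have := hdiff.comp (tendsto_atBot_add_const_right atBot (-1) tendsto_id)
    refine this.congr fun x => ?_
    simp [sub_eq_add_neg]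
  have hf : Tendsto (fun x => fSIR τ η s₀ (u x)) atBot (𝓝 0) := by
    have h1 := hJb.sub ((hdiff'.sub hdiff).const_mul lam)
    simp only [sub_self, mul_zero] at h1
    exact h1.congr fun x => (key x).symm
  have hbdd : BddAbove (range u) := by
    obtain ⟨N, hN⟩ := (hf.eventually (lt_mem_nhds (by norm_num : (-1:ℝ) < 0))).exists_forall_of_atBot
    refine ⟨(s₀ + 1) / η, ?_⟩
    rintro _ ⟨x, rfl⟩
    have h1 := hN (min x N) (min_le_right _ _)
    have h2 : u x ≤ u (min x N) := hanti.antitone (min_le_left _ _)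
    simp only [fSIR] at h1
    have h3 := mul_pos hs (Real.exp_pos (-τ * u (min x N)))
    rw [le_div_iff₀ hη]
    nlinarith
  have hL := tendsto_atBot_ciSup hanti.antitone hbdd
  have hLpos : 0 < ⨆ x, u x := (upos 0).trans_le (le_ciSup hbdd 0)
  have hfL : Tendsto (fun x => fSIR τ η s₀ (u x)) atBot (𝓝 (fSIR τ η s₀ (⨆ x, u x))) :=
    (((hL.const_mul (-τ)).rexp).const_sub 1).const_mul s₀ |>.sub (hL.const_mul η)
  have := huniq _ hLpos (tendsto_nhds_unique hfL hf)
  rw [this] at hL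
  rw [show S = fun x => s₀ * Real.exp (-τ * u x) from funext hSu]
  exact ((hL.const_mul (-τ)).rexp).const_mul s₀

/-- Assume `𝓡₀ = s₀τ/η > 1` and let `c_* = min_{γ>0} [η(𝓡₀-1) + λ(e^{-γ}-2+e^{γ})]/γ`.
Then traveling wave solutions exist for every speed `c ≥ c_*`, and any such
solution satisfies `S(-∞) = s₀ e^{-τ I_*}`, where `I_*` is the unique positive zero
of `f`. -/
theorem stmt_6 (τ η lam s₀ : ℝ) (hτ : 0 < τ) (hη : 0 < η) (hlam : 0 < lam)
    (hs₀ : s₀ ∈ Set.Ioo (0 : ℝ) 1) (hR0 : 1 < s₀ * τ / η)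
    (cstar : ℝ)
    (hcstar : IsLeast {v : ℝ | ∃ γ : ℝ, 0 < γ ∧
        v = (η * (s₀ * τ / η - 1) + lam * (Real.exp (-γ) - 2 + Real.exp γ)) / γ} cstar)
    (Istar : ℝ) (hIstar_pos : 0 < Istar) (hIstar_zero : fSIR τ η s₀ Istar = 0)
    (hIstar_uniq : ∀ v : ℝ, 0 < v → fSIR τ η s₀ v = 0 → v = Istar) :
    (∀ c : ℝ, cstar ≤ c → ∃ S I : ℝ → ℝ, IsTravelingWave τ η lam s₀ c S I) ∧
    (∀ c : ℝ, cstar ≤ c → ∀ S I : ℝ → ℝ, IsTravelingWave τ η lam s₀ c S I →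
      Filter.Tendsto S Filter.atBot (nhds (s₀ * Real.exp (-τ * Istar)))) := by
  have hs := hs₀.1
  have hpos : 0 < η * (s₀ * τ / η - 1) := mul_pos hη (by linarith)
  have he : η * (s₀ * τ / η - 1) = s₀ * τ - η := by field_simp
  obtain ⟨γ, hγ, hcγ⟩ := hcstar.1
  have hq : 0 ≤ Real.exp (-γ) - 2 + Real.exp γ := by
    have h1 := Real.add_one_le_exp γ
    have h2 := Real.add_one_le_exp (-γ)
    linarith
  have hc0 : 0 < cstar := by
    rw [hcγ]
    have := mul_nonneg hlam.le hq
    positivity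
  refine ⟨fun c hc => ?_, fun c hc S J h => part_two (hc0.trans_le hc) hτ hη hs hIstar_uniq h⟩
  refine part_one (hc0.trans_le hc) hτ hη hlam hs hγ ?_ hIstar_pos hIstar_zero hIstar_uniq
  rw [hcγ, he, div_le_iff₀ hγ] at hc
  exact hc
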